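/- arXiv:2006.16520 — 2 statements merged into one kernel-verified Lean document; each statement's English description precedes it below -/
import Mathlib

section
/- For every finite set Q ⊆ ℝ², there exist two halfspace classifiers h₁, h₂ (each of the form h(z) = 1 iff ⟨a,z⟩ + b ≥ 0 with a ≠ 0) such that: (i) h₁(q) = h₂(q) for every q ∈ Q ∪ {0}; (ii) there exists z with ‖z‖₂ ≤ 1 and h₁(z) ≠ h₁(0); and (iii) h₂(z) = h₂(0) for every z with ‖z‖₂ ≤ 1. (Hence no deterministic query-based certifier can determine from finitely many label queries whether the origin lies in the ℓ²-margin of an unknown halfspace, and the class of halfspaces in ℝ² is not certifiable with respect to ℓ²-unit-ball perturbations.) -/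
open MeasureTheory Set
open scoped ENNReal symmDiff

namespace AdvRobust

variable {X : Type*}

/-- Error region of a hypothesis `h : X → Bool`, as a subset of `X × Bool`. -/
def errSet (h : X → Bool) : Set (X × Bool) := {p | h p.1 ≠ p.2}

/-- Margin area of a hypothesis w.r.t. perturbation type `U`, as a subset of `X × Bool`. -/
def marSet (U : X → Set X) (h : X → Bool) : Set (X × Bool) :=
  {p | ∃ z ∈ U p.1, h z ≠ h p.1}

/-- Margin area of a hypothesis, identified with a subset of the domain `X`. -/
def marSetX (U : X → Set X) (h : X → Bool) : Set X :=
  {x | ∃ z ∈ U x, h z ≠ h x}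

/-- Robust loss `L^U_P(h) = P(err(h) ∪ mar_U(h))`. -/
noncomputable def robustLoss [MeasurableSpace X] (U : X → Set X)
    (P : Measure (X × Bool)) (h : X → Bool) : ℝ≥0∞ :=
  P (errSet h ∪ marSet U h)

/-- Binary (0/1) loss `L^{0/1}_P(h) = P(err(h))`. -/
noncomputable def binLoss [MeasurableSpace X]
    (P : Measure (X × Bool)) (h : X → Bool) : ℝ≥0∞ :=
  P (errSet h)

/-- Robust loss via the pointwise robust loss set `{(x,y) | ∃ z ∈ U x, h z ≠ y}`. -/
noncomputable def robustLoss' [MeasurableSpace X] (U : X → Set X)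
    (P : Measure (X × Bool)) (h : X → Bool) : ℝ≥0∞ :=
  P {p : X × Bool | ∃ z ∈ U p.1, h z ≠ p.2}

/-- A family of sets `G` shatters a finite set `B`. -/
def Shatters {Z : Type*} (G : Set (Set Z)) (B : Finset Z) : Prop :=
  ∀ F ⊆ B, ∃ g ∈ G, ∀ z ∈ B, (z ∈ g ↔ z ∈ F)

/-- The VC-dimension of `G` is at most `d`. -/
def VCdimLE {Z : Type*} (G : Set (Set Z)) (d : ℕ) : Prop :=
  ∀ B : Finset Z, Shatters G B → B.card ≤ d

/-- The VC-dimension of `G` equals `d`. -/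
def VCdimEq {Z : Type*} (G : Set (Set Z)) (d : ℕ) : Prop :=
  VCdimLE G d ∧ ∃ B : Finset Z, Shatters G B ∧ B.card = d

/-- The family `{h⁻¹(1) : h ∈ H}` associated with a class of Boolean hypotheses. -/
def classSets (H : Set (X → Bool)) : Set (Set X) := (fun h => h ⁻¹' {true}) '' H

/-- The margin class `{mar_U(h) : h ∈ H}`. -/
def marginClass (U : X → Set X) (H : Set (X → Bool)) : Set (Set (X × Bool)) :=
  (marSet U) '' H

/-- The halfspace classifier in `ℝ²`: `hs a b z = 1` iff `⟨a,z⟩ + b ≥ 0`. -/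
noncomputable def hs (a : ℝ × ℝ) (b : ℝ) (z : ℝ × ℝ) : Bool :=
  if 0 ≤ a.1 * z.1 + a.2 * z.2 + b then true else false

/-- The Euclidean (`ℓ²`) norm on `ℝ × ℝ`. -/
noncomputable def nrm2 (z : ℝ × ℝ) : ℝ := Real.sqrt (z.1 ^ 2 + z.2 ^ 2)

/-- Finitely many points can be avoided by some tangent line of the unit circle. -/
theorem exists_unit_forall_inner_ne_one (Q : Finset (ℝ × ℝ)) :
    ∃ u : ℝ × ℝ, u.1 ^ 2 + u.2 ^ 2 = 1 ∧ ∀ q ∈ Q, u.1 * q.1 + u.2 * q.2 ≠ 1 := by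
  classical
  let p : ℝ × ℝ → Polynomial ℝ := fun q =>
    Polynomial.C (q.1 + 1) * Polynomial.X ^ 2 - Polynomial.C (2 * q.2) * Polynomial.X
      + Polynomial.C (1 - q.1)
  have eval_p (q : ℝ × ℝ) (t : ℝ) :
      (p q).eval t = (q.1 + 1) * t ^ 2 - 2 * q.2 * t + (1 - q.1) := by
    simp [p]
  have p_ne_zero (q : ℝ × ℝ) : p q ≠ 0 := by
    intro h
    have h0 := eval_p q 0
    have h1 := eval_p q 1
    have h2 := eval_p q (-1)
    rw [h, Polynomial.eval_zero] at h0 h1 h2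
    linarith
  obtain ⟨t, ht⟩ := Infinite.exists_notMem_finset (Q.biUnion fun q => (p q).roots.toFinset)
  have hpos : 1 + t ^ 2 ≠ 0 := by positivity
  refine ⟨((1 - t ^ 2) / (1 + t ^ 2), 2 * t / (1 + t ^ 2)), ?_, fun q hq h => ht ?_⟩
  · field_simp
    ring
  · rw [Finset.mem_biUnion]
    refine ⟨q, hq, ?_⟩
    rw [Multiset.mem_toFinset, Polynomial.mem_roots (p_ne_zero q), Polynomial.IsRoot.def, eval_p]
    field_simp at h
    linarith

/-- A finite family of reals avoiding `1` has a gap immediately above `1`. -/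
theorem exists_gap_above_one {ι : Type*} (Q : Finset ι) (f : ι → ℝ) (hf : ∀ q ∈ Q, f q ≠ 1) :
    ∃ c : ℝ, 1 < c ∧ ∀ q ∈ Q, 1 ≤ f q ↔ c ≤ f q := by
  have h : ∀ᶠ c in nhdsWithin (1 : ℝ) (Set.Ioi 1), ∀ q ∈ Q, 1 < f q → c ≤ f q := by
    refine (Filter.eventually_all_finset Q).2 fun q _ => ?_
    by_cases hq : 1 < f q
    · filter_upwards [nhdsWithin_le_nhds (Iic_mem_nhds hq)] with c hc _ using hc
    · exact Filter.Eventually.of_forall fun c h => absurd h hq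
  obtain ⟨c, hc, hc1⟩ := (h.and self_mem_nhdsWithin).exists
  have hc1 : 1 < c := hc1
  exact ⟨c, hc1, fun q hq =>
    ⟨fun h => hc q hq (lt_of_le_of_ne h (hf q hq).symm), fun h => hc1.le.trans h⟩⟩

/-- For every finite query set `Q ⊆ ℝ²` there are two halfspaces that
agree on `Q ∪ {0}`, one of which has an adversarial point for the origin within the
`ℓ²`-unit ball while the other has none: halfspaces in `ℝ²` are not certifiable w.r.t.
`ℓ²`-unit-ball perturbations by a deterministic query-based certifier. -/
theorem statement7 (Q : Finset (ℝ × ℝ)) :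
    ∃ (a₁ a₂ : ℝ × ℝ) (b₁ b₂ : ℝ), a₁ ≠ 0 ∧ a₂ ≠ 0 ∧
      (∀ q : ℝ × ℝ, q ∈ Q ∨ q = 0 → hs a₁ b₁ q = hs a₂ b₂ q) ∧
      (∃ z : ℝ × ℝ, nrm2 z ≤ 1 ∧ hs a₁ b₁ z ≠ hs a₁ b₁ 0) ∧
      (∀ z : ℝ × ℝ, nrm2 z ≤ 1 → hs a₂ b₂ z = hs a₂ b₂ 0) := by
  obtain ⟨u, hu, hQ⟩ := exists_unit_forall_inner_ne_one Q
  obtain ⟨c, hc, hcQ⟩ := exists_gap_above_one Q (fun q => u.1 * q.1 + u.2 * q.2) hQ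
  have hu0 : u ≠ 0 := by
    rintro rfl
    norm_num at hu
  have hs_zero (d : ℝ) (hd : 0 < d) : hs u (-d) 0 = false := by
    simp [hs, hd]
  refine ⟨u, u, -1, -c, hu0, hu0, ?_, ⟨u, ?_, ?_⟩, fun z hz => ?_⟩
  · rintro q (hq | rfl)
    · have h := hcQ q hq
      simp only [hs, ← sub_eq_add_neg, sub_nonneg, h]
    · rw [hs_zero 1 one_pos, hs_zero c (by linarith)]
  · simp [nrm2, hu]
  · rw [hs_zero 1 one_pos]
    have h : 0 ≤ u.1 * u.1 + u.2 * u.2 + -1 := by nlinarith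
    simp [hs, h]
  · rw [hs_zero c (by linarith)]
    have hz : z.1 ^ 2 + z.2 ^ 2 ≤ 1 := by
      simpa [nrm2] using hz
    have h : ¬ 0 ≤ u.1 * z.1 + u.2 * z.2 + -c := by
      nlinarith [sq_nonneg (u.1 - z.1), sq_nonneg (u.2 - z.2)]
    simp only [hs, if_neg h]

end AdvRobust
end

section
/- Fix γ > 0. For p ∈ ℝ², let h_p : ℝ² → {0,1} be defined by h_p(z) = 1 iff z = p, and let H = {h_p : p ∈ ℝ²}. Then: (i) VC(H) = 1; and (ii) for every finite set Q ⊆ ℝ² there exist p₁, p₂ ∈ ℝ² \ (Q ∪ {0}) with 0 < ‖p₁‖₂ ≤ 1 and ‖p₂‖₂ > 1 + γ; consequently h_{p₁} and h_{p₂} agree on Q ∪ {0}, there exists z with ‖z‖₂ ≤ 1 and h_{p₁}(z) ≠ h_{p₁}(0), while h_{p₂}(z) = h_{p₂}(0) for all z with ‖z‖₂ ≤ 1 + γ. (Hence H, despite having VC-dimension 1, is not tolerantly certifiable with respect to ℓ²-balls of radii 1 and 1+γ by any deterministic query-based certifier.) -/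
open MeasureTheory Set
open scoped ENNReal symmDiff

namespace AdvRobust

variable {X : Type*}

/-- The singleton classifier `h_p : h_p(z) = 1` iff `z = p`. -/
noncomputable def hpt (p : ℝ × ℝ) (z : ℝ × ℝ) : Bool :=
  if z = p then true else false

theorem hpt_eq_true_iff {p z : ℝ × ℝ} : hpt p z = true ↔ z = p := by
  simp [hpt]

theorem hpt_of_ne {p z : ℝ × ℝ} (h : z ≠ p) : hpt p z = false := by
  simp [hpt, h]

theorem nrm2_zero : nrm2 0 = 0 := by
  simp [nrm2]

theorem nrm2_mk_zero {t : ℝ} (ht : 0 ≤ t) : nrm2 (t, 0) = t := by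
  simp [nrm2, Real.sqrt_sq ht]

theorem mem_classSets_hpt {g : Set (ℝ × ℝ)} :
    g ∈ classSets {h | ∃ p : ℝ × ℝ, h = hpt p} ↔ ∃ p, g = {p} := by
  have preimage_hpt (p : ℝ × ℝ) : hpt p ⁻¹' {true} = {p} := by
    ext z
    simp [hpt_eq_true_iff]
  constructor
  · rintro ⟨_, ⟨p, rfl⟩, rfl⟩
    exact ⟨p, preimage_hpt p⟩
  · rintro ⟨p, rfl⟩
    exact ⟨hpt p, ⟨p, rfl⟩, preimage_hpt p⟩

theorem vcdimEq_classSets_hpt : VCdimEq (classSets {h | ∃ p : ℝ × ℝ, h = hpt p}) 1 := by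
  refine ⟨fun B hB => ?_, {0}, fun F _ => ?_, Finset.card_singleton _⟩
  · obtain ⟨g, hg, hgB⟩ := hB B subset_rfl
    obtain ⟨p, rfl⟩ := mem_classSets_hpt.1 hg
    refine Finset.card_le_one.2 fun a ha b hb => ?_
    exact ((hgB a ha).2 ha).trans ((hgB b hb).2 hb).symm
  · by_cases h0 : (0 : ℝ × ℝ) ∈ F
    · exact ⟨{0}, mem_classSets_hpt.2 ⟨0, rfl⟩, by simp [h0]⟩
    · exact ⟨{1}, mem_classSets_hpt.2 ⟨1, rfl⟩, by simp [h0]⟩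

/-- Any nondegenerate interval of radii contains the norm of a point outside a finite set. -/
theorem exists_notMem_nrm2_mem_Ioo (Q : Finset (ℝ × ℝ)) {a b : ℝ} (ha : 0 ≤ a) (hab : a < b) :
    ∃ p ∉ Q, nrm2 p ∈ Ioo a b := by
  have hinj : InjOn (fun t : ℝ => (t, (0 : ℝ))) (Ioo a b) :=
    fun _ _ _ _ h => congrArg Prod.fst h
  obtain ⟨_, ⟨t, ht, rfl⟩, hQ⟩ := ((Ioo_infinite hab).image hinj).exists_notMem_finset Q
  exact ⟨_, hQ, by rwa [nrm2_mk_zero (ha.trans ht.1.le)]⟩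

/-- The class `H = {h_p : p ∈ ℝ²}` of singleton classifiers has
VC-dimension 1, yet for every finite query set `Q` there are `p₁, p₂ ∉ Q ∪ {0}` with
`0 < ‖p₁‖ ≤ 1 < 1 + γ < ‖p₂‖` such that `h_{p₁}` and `h_{p₂}` agree on `Q ∪ {0}`, the
origin lies in the radius-1 margin of `h_{p₁}`, but not in the radius-`(1+γ)` margin of
`h_{p₂}`: hence `H` is not tolerantly certifiable. -/
theorem statement10 (γ : ℝ) (hγ : 0 < γ) :
    VCdimEq (classSets {h | ∃ p : ℝ × ℝ, h = hpt p}) 1 ∧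
    ∀ Q : Finset (ℝ × ℝ), ∃ p₁ p₂ : ℝ × ℝ,
      p₁ ∉ Q ∧ p₁ ≠ 0 ∧ p₂ ∉ Q ∧ p₂ ≠ 0 ∧
      0 < nrm2 p₁ ∧ nrm2 p₁ ≤ 1 ∧ 1 + γ < nrm2 p₂ ∧
      (∀ q : ℝ × ℝ, q ∈ Q ∨ q = 0 → hpt p₁ q = hpt p₂ q) ∧
      (∃ z : ℝ × ℝ, nrm2 z ≤ 1 ∧ hpt p₁ z ≠ hpt p₁ 0) ∧
      (∀ z : ℝ × ℝ, nrm2 z ≤ 1 + γ → hpt p₂ z = hpt p₂ 0) := by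
  refine ⟨vcdimEq_classSets_hpt, fun Q => ?_⟩
  obtain ⟨p₁, hQ₁, hpos, hle⟩ := exists_notMem_nrm2_mem_Ioo Q le_rfl zero_lt_one
  obtain ⟨p₂, hQ₂, hgt, -⟩ :=
    exists_notMem_nrm2_mem_Ioo Q (by positivity : 0 ≤ 1 + γ) (lt_add_one _)
  have h₁ : p₁ ≠ 0 := by
    rintro rfl
    exact hpos.ne' nrm2_zero
  have hfar : ∀ z : ℝ × ℝ, nrm2 z ≤ 1 + γ → z ≠ p₂ := by
    rintro z hz rfl
    exact hgt.not_ge hz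
  have h₂ : 0 ≠ p₂ := hfar 0 (by rw [nrm2_zero]; positivity)
  refine ⟨p₁, p₂, hQ₁, h₁, hQ₂, h₂.symm, hpos, hle.le, hgt, ?_, ⟨p₁, hle.le, ?_⟩, fun z hz => ?_⟩
  · rintro q (hq | rfl)
    · rw [hpt_of_ne (ne_of_mem_of_not_mem hq hQ₁), hpt_of_ne (ne_of_mem_of_not_mem hq hQ₂)]
    · rw [hpt_of_ne h₁.symm, hpt_of_ne h₂]
  · simp [hpt_eq_true_iff.2 rfl, hpt_of_ne h₁.symm]
  · rw [hpt_of_ne (hfar z hz), hpt_of_ne h₂]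

end AdvRobust
end
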